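/- Let G be a DAG over a target vertex Y and covariates X, let X₀ ⊆ X be a nonempty set of covariates whose induced subgraph of the skeleton is connected and such that Y is adjacent to some vertex of X₀, and suppose every vertex of X ∖ X₀ is adjacent to at most one vertex of X₀ ∪ {Y}. Let G̃ be the graph over a target Ỹ and covariates X ∖ X₀ obtained by contracting X₀ ∪ {Y} into Ỹ: for V ∈ X ∖ X₀, G̃ has Ỹ → V if and only if G has an edge from some vertex of X₀ ∪ {Y} into V, and V → Ỹ if and only if G has an edge from V into some vertex of X₀ ∪ {Y}; all edges among X ∖ X₀ are as in G. Assume G̃ is acyclic. Then N_{G̃} + |X₀| ≤ N_G ≤ 2^{|X₀|}·N_{G̃}. -/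

import Mathlib

/-- A finite directed acyclic graph on a vertex type `V`: an edge relation with no
directed cycles. -/
structure DAG (V : Type*) where
  edge : V → V → Prop
  acyclic : ∀ v, ¬ Relation.TransGen edge v v

/-- A path: a sequence of at least two distinct vertices in which consecutive vertices
are joined by an edge (in either direction). -/
def IsPath {V : Type*} (E : V → V → Prop) (p : List V) : Prop :=
  2 ≤ p.length ∧ p.Nodup ∧
    ∀ i, ∀ h : i + 1 < p.length,
      E (p.get ⟨i, Nat.lt_of_succ_lt h⟩) (p.get ⟨i + 1, h⟩) ∨
      E (p.get ⟨i + 1, h⟩) (p.get ⟨i, Nat.lt_of_succ_lt h⟩)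

/-- The vertex at position `i` of the path `p` is a collider on `p`: it is an interior
vertex and both adjacent edges of the path point into it. -/
def IsColliderAt {V : Type*} (E : V → V → Prop) (p : List V) (i : ℕ) : Prop :=
  ∃ (h1 : 1 ≤ i) (h2 : i + 1 < p.length),
    E (p.get ⟨i - 1, by omega⟩) (p.get ⟨i, by omega⟩) ∧
    E (p.get ⟨i + 1, h2⟩) (p.get ⟨i, by omega⟩)

/-- A path is blocked by a vertex set `Z` if it contains a non-collider belonging to
`Z`, or a collider such that neither the collider itself nor any of its descendants
belongs to `Z`. -/
def Blocked {V : Type*} (E : V → V → Prop) (Z : Set V) (p : List V) : Prop :=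
  (∃ i, ∃ h : i < p.length, ¬ IsColliderAt E p i ∧ p.get ⟨i, h⟩ ∈ Z) ∨
  (∃ i, ∃ h : i < p.length, IsColliderAt E p i ∧ p.get ⟨i, h⟩ ∉ Z ∧
    ∀ w, Relation.TransGen E (p.get ⟨i, h⟩) w → w ∉ Z)

/-- `p` is a path between the vertices `u` and `v`. -/
def PathBetween {V : Type*} (E : V → V → Prop) (p : List V) (u v : V) : Prop :=
  IsPath E p ∧ p.head? = some u ∧ p.getLast? = some v

/-- `A` is d-separated from `B` given `Z`: every path between a vertex of `A` and a
vertex of `B` is blocked by `Z`. -/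
def DSep {V : Type*} (E : V → V → Prop) (A B Z : Set V) : Prop :=
  ∀ (p : List V) (u v : V), PathBetween E p u v → u ∈ A → v ∈ B → Blocked E Z p

/-- The set of covariate vertices (in `Option ι`, the target is `none` and the covariate
with index `i` is `some i`) indexed by a finite index set `S`. -/
def XSet {ι : Type*} (S : Finset ι) : Set (Option ι) := {v | ∃ i ∈ S, v = some i}

/-- The equivalence relation `∼_G` on subsets of the covariate index set: `S' ∼_G S''`
iff there is `S_∩ ⊆ S' ∩ S''` such that the target `Y` (= `none`) is d-separated from
`X_{(S' ∪ S'') ∖ S_∩}` given `X_{S_∩}` in `G`. -/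
def SimG {ι : Type*} [DecidableEq ι] (G : DAG (Option ι)) (S' S'' : Finset ι) : Prop :=
  ∃ Scap : Finset ι, Scap ⊆ S' ∩ S'' ∧
    DSep G.edge {none} (XSet ((S' ∪ S'') \ Scap)) (XSet Scap)

/-- `N_G`: the number of equivalence classes of `∼_G`. -/
noncomputable def NG {ι : Type*} [DecidableEq ι] (G : DAG (Option ι)) : ℕ :=
  Nat.card (Quot (SimG G))

/-- Adjacency in the skeleton of a DAG. -/
def SkelAdj {V : Type*} (G : DAG V) (a b : V) : Prop := G.edge a b ∨ G.edge b a

/-- The edge relation obtained from a graph over target `Y` (= `none`) and covariates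
`ι` by contracting `{Y} ∪ X₀` into a single new target `Ỹ`: for a remaining covariate
`v`, `Ỹ → v` iff `G` has an edge from some vertex of `{Y} ∪ X₀` into `v`, and `v → Ỹ`
iff `G` has an edge from `v` into some vertex of `{Y} ∪ X₀`; edges among remaining
covariates are unchanged. -/
def contractEdgeSet {ι : Type*} (E : Option ι → Option ι → Prop) (X0 : Finset ι) :
    Option {i : ι // i ∉ X0} → Option {i : ι // i ∉ X0} → Prop
  | none, none => False
  | none, some v => E none (some v.1) ∨ ∃ i ∈ X0, E (some i) (some v.1)
  | some v, none => E (some v.1) none ∨ ∃ i ∈ X0, E (some v.1) (some i)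
  | some v, some w => E (some v.1) (some w.1)


/-- Bayes-ball reachability: `BReach E Z y d v` says there is a walk from `y` to `v`, open given
`Z`, whose last edge points into `v` (`d = true`) or out of `v` (`d = false`). -/
inductive BReach {V : Type*} (E : V → V → Prop) (Z : Set V) (y : V) : Bool → V → Prop
  | start : BReach E Z y false y
  | fwd {d v w} : BReach E Z y d v → v ∉ Z → E v w → BReach E Z y true w
  | bwdT {v w} : BReach E Z y false v → v ∉ Z → E w v → BReach E Z y false w
  | bwdH {v w} : BReach E Z y true v → v ∈ Z → E w v → BReach E Z y false w

/-- Ancestors (reflexively) of `Z`. -/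
def AncOf {V : Type*} (E : V → V → Prop) (Z : Set V) (v : V) : Prop :=
  ∃ z ∈ Z, Relation.ReflTransGen E v z

theorem BReach.turn {V : Type*} {E : V → V → Prop} {Z : Set V} {y v : V}
    (hr : BReach E Z y true v) (ha : AncOf E Z v) : v ∈ Z ∨ BReach E Z y false v := by
  obtain ⟨z, hz, h⟩ := ha
  induction h using Relation.ReflTransGen.head_induction_on with
  | refl => exact Or.inl hz
  | @head a c hac hcz ih =>
    by_cases haZ : a ∈ Z
    · exact Or.inl haZ
    · right
      have hc := hr.fwd haZ hac
      by_cases hcZ : c ∈ Z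
      · exact hc.bwdH hcZ hac
      · exact ((ih hc).resolve_left hcZ).bwdT hcZ hac

theorem BReach.bwdAn {V : Type*} {E : V → V → Prop} {Z : Set V} {y v w : V}
    (hr : BReach E Z y true v) (ha : AncOf E Z v) (hw : E w v) : BReach E Z y false w := by
  by_cases hv : v ∈ Z
  · exact hr.bwdH hv hw
  · exact ((hr.turn ha).resolve_left hv).bwdT hv hw

/-- Open paths, as reversed lists (the current endpoint is the head of the list). -/
inductive OPath {V : Type*} (E : V → V → Prop) (Z : Set V) (y : V) : List V → Bool → Prop
  | nil : OPath E Z y [y] false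
  | fwd {d v w l} : OPath E Z y (v :: l) d → v ∉ Z → E v w → w ∉ v :: l →
      OPath E Z y (w :: v :: l) true
  | bwdT {v w l} : OPath E Z y (v :: l) false → v ∉ Z → E w v → w ∉ v :: l →
      OPath E Z y (w :: v :: l) false
  | bwdH {v w l} : OPath E Z y (v :: l) true → AncOf E Z v → E w v → w ∉ v :: l →
      OPath E Z y (w :: v :: l) false

theorem AncOf.step {V : Type*} {E : V → V → Prop} {Z : Set V} {v w : V}
    (h : AncOf E Z w) (e : E v w) : AncOf E Z v := by
  obtain ⟨z, hz, h⟩ := h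
  exact ⟨z, hz, Relation.ReflTransGen.head e h⟩

theorem AncOf.trans {V : Type*} {E : V → V → Prop} {Z : Set V} {v w : V}
    (h : AncOf E Z w) (e : Relation.ReflTransGen E v w) : AncOf E Z v := by
  obtain ⟨z, hz, h⟩ := h
  exact ⟨z, hz, e.trans h⟩

theorem OPath.suffix {V : Type*} {E : V → V → Prop} {Z : Set V} {y : V} {q : List V} {d : Bool}
    (h : OPath E Z y q d) : ∀ v l, q = v :: l → ∀ w ∈ l, ∃ l' d', OPath E Z y (w :: l') d' ∧
      (d' = false → w ∉ Z) ∧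
      (d' = true → AncOf E Z w ∨ (d = true ∧ Relation.ReflTransGen E w v)) := by
  induction h with
  | nil => intro v l h w hw; simp at h; simp [h.2] at hw
  | @fwd d v w l hp hv he hn ih =>
    intro v' l' hq x hx
    obtain ⟨rfl, rfl⟩ := List.cons.inj hq
    rcases List.mem_cons.1 hx with rfl | hx
    · exact ⟨l, d, hp, fun _ => hv, fun _ => Or.inr ⟨rfl, .single he⟩⟩
    · obtain ⟨l', d', h1, h2, h3⟩ := ih v l rfl x hx
      exact ⟨l', d', h1, h2, fun hd => (h3 hd).imp_right fun h => ⟨rfl, h.2.tail he⟩⟩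
  | @bwdT v w l hp hv he hn ih =>
    intro v' l' hq x hx
    obtain ⟨rfl, rfl⟩ := List.cons.inj hq
    rcases List.mem_cons.1 hx with rfl | hx
    · exact ⟨l, _, hp, fun _ => hv, fun h => by simp at h⟩
    · obtain ⟨l', d', h1, h2, h3⟩ := ih v l rfl x hx
      exact ⟨l', d', h1, h2, fun hd => (h3 hd).imp_right fun h => by simp at h⟩
  | @bwdH v w l hp hv he hn ih =>
    intro v' l' hq x hx
    obtain ⟨rfl, rfl⟩ := List.cons.inj hq
    rcases List.mem_cons.1 hx with rfl | hx
    · exact ⟨l, _, hp, fun h => by simp at h, fun h => Or.inl hv⟩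
    · obtain ⟨l', d', h1, h2, h3⟩ := ih v l rfl x hx
      refine ⟨l', d', h1, h2, fun hd => Or.inl ?_⟩
      rcases h3 hd with h | h
      · exact h
      · exact hv.trans h.2

theorem BReach.toOPath {V : Type*} {E : V → V → Prop} {Z : Set V} {y : V}
    (hirr : ∀ v, ¬ E v v) {d : Bool} {v : V} (h : BReach E Z y d v) :
    ∃ l d', OPath E Z y (v :: l) d' ∧ (d = true → d' = true ∨ v ∉ Z) ∧
      (d = false → d' = false ∨ AncOf E Z v) := by
  induction h with
  | start => exact ⟨[], false, .nil, by simp, by simp⟩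
  | @fwd d v w hr hv he ih =>
    obtain ⟨l, d', hp, h1, h2⟩ := ih
    by_cases hw : w ∈ v :: l
    · have hwl : w ∈ l := by
        rcases List.mem_cons.1 hw with rfl | h
        · exact absurd he (hirr _)
        · exact h
      obtain ⟨l', d'', g1, g2, g3⟩ := hp.suffix v l rfl w hwl
      refine ⟨l', d'', g1, fun _ => ?_, by simp⟩
      cases d'' with
      | true => simp
      | false => exact Or.inr (g2 rfl)
    · exact ⟨_, true, hp.fwd hv he hw, by simp, by simp⟩
  | @bwdT v w hr hv he ih =>
    obtain ⟨l, d', hp, h1, h2⟩ := ih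
    by_cases hw : w ∈ v :: l
    · have hwl : w ∈ l := by
        rcases List.mem_cons.1 hw with rfl | h
        · exact absurd he (hirr _)
        · exact h
      obtain ⟨l', d'', g1, g2, g3⟩ := hp.suffix v l rfl w hwl
      refine ⟨l', d'', g1, by simp, fun _ => ?_⟩
      cases d'' with
      | false => simp
      | true =>
        right
        rcases g3 rfl with g | ⟨g, g'⟩
        · exact g
        · subst g
          exact ((h2 rfl).resolve_left (by simp)).trans g'
    · cases d' with
      | false => exact ⟨_, false, hp.bwdT hv he hw, by simp, by simp⟩
      | true => exact ⟨_, false, hp.bwdH ((h2 rfl).resolve_left (by simp)) he hw, by simp, by simp⟩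
  | @bwdH v w hr hv he ih =>
    obtain ⟨l, d', hp, h1, h2⟩ := ih
    have hd' : d' = true := (h1 rfl).resolve_right (by simpa using hv)
    subst hd'
    have hvA : AncOf E Z v := ⟨v, hv, .refl⟩
    by_cases hw : w ∈ v :: l
    · have hwl : w ∈ l := by
        rcases List.mem_cons.1 hw with rfl | h
        · exact absurd he (hirr _)
        · exact h
      obtain ⟨l', d'', g1, g2, g3⟩ := hp.suffix v l rfl w hwl
      refine ⟨l', d'', g1, by simp, fun _ => ?_⟩
      cases d'' with
      | false => simp
      | true =>
        right
        rcases g3 rfl with g | ⟨g, g'⟩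
        · exact g
        · exact hvA.trans g'
    · exact ⟨_, false, hp.bwdH hvA he hw, by simp, by simp⟩

theorem isColliderAt_iff {V : Type*} (E : V → V → Prop) (p : List V) (i : ℕ) :
    IsColliderAt E p i ↔ ∃ j a b c, i = j + 1 ∧ p[j]? = some a ∧ p[j+1]? = some b ∧
      p[j+2]? = some c ∧ E a b ∧ E c b := by
  constructor
  · rintro ⟨h1, h2, h3, h4⟩
    obtain ⟨j, rfl⟩ : ∃ j, i = j + 1 := ⟨i - 1, by omega⟩
    refine ⟨j, _, _, _, rfl, List.getElem?_eq_getElem (by omega),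
      List.getElem?_eq_getElem (by omega), List.getElem?_eq_getElem (by omega), ?_, ?_⟩
    · simpa using h3
    · simpa using h4
  · rintro ⟨j, a, b, c, rfl, ha, hb, hc, h1, h2⟩
    obtain ⟨l1, rfl⟩ := List.getElem?_eq_some_iff.1 ha
    obtain ⟨l2, rfl⟩ := List.getElem?_eq_some_iff.1 hb
    obtain ⟨l3, rfl⟩ := List.getElem?_eq_some_iff.1 hc
    exact ⟨by omega, by omega, by simpa using h1, by simpa using h2⟩

/-- Index-free-of-proofs characterization of being an open path (except for the last vertex). -/
structure OpenIdx {V : Type*} (E : V → V → Prop) (Z : Set V) (p : List V) : Prop where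
  nodup : p.Nodup
  adj : ∀ i a b, p[i]? = some a → p[i+1]? = some b → E a b ∨ E b a
  zero : ∀ a b, p[0]? = some a → p[1]? = some b → a ∉ Z
  col : ∀ i a b c, p[i]? = some a → p[i+1]? = some b → p[i+2]? = some c →
    (E a b ∧ E c b → AncOf E Z b) ∧ (¬ (E a b ∧ E c b) → b ∉ Z)

/-- Last direction of a reversed list. -/
def LastDir {V : Type*} (E : V → V → Prop) : List V → Bool → Prop
  | [] , _ => True
  | [_], d => d = false
  | w :: v :: _, d => if d then E v w else E w v

theorem OpenIdx.snoc {V : Type*} {E : V → V → Prop} {Z : Set V} {p : List V} {v w : V}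
    (h : OpenIdx E Z (p ++ [v])) (hn : w ∉ p ++ [v]) (ha : E v w ∨ E w v)
    (h0 : p = [] → v ∉ Z)
    (hc : ∀ q a, p = q ++ [a] → (E a v ∧ E w v → AncOf E Z v) ∧ (¬ (E a v ∧ E w v) → v ∉ Z)) :
    OpenIdx E Z (p ++ [v] ++ [w]) := by
  have key : ∀ i a, (p ++ [v] ++ [w])[i]? = some a →
      (i < p.length + 1 ∧ (p ++ [v])[i]? = some a) ∨ (i = p.length + 1 ∧ a = w) := by
    intro i a hi
    rcases lt_trichotomy i (p.length + 1) with h' | h' | h'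
    · rw [List.getElem?_append_left (by simpa using h')] at hi
      exact Or.inl ⟨h', hi⟩
    · subst h'
      rw [List.getElem?_append_right (by simp)] at hi
      simp at hi
      exact Or.inr ⟨rfl, hi.symm⟩
    · rw [List.getElem?_eq_none (by simp; omega)] at hi
      simp at hi
  have hlast : ∀ a, (p ++ [v])[p.length]? = some a → a = v := by
    intro a h
    rw [List.getElem?_append_right (by simp)] at h
    simpa using h.symm
  refine ⟨?_, ?_, ?_, ?_⟩
  · rw [List.nodup_append]
    refine ⟨h.nodup, by simp, ?_⟩
    rintro a haa b hb rfl
    simp at hb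
    subst hb
    exact hn haa
  · intro i a b h1 h2
    rcases key _ _ h2 with ⟨l2, h2⟩ | ⟨l2, rfl⟩
    · rcases key _ _ h1 with ⟨l1, h1⟩ | ⟨l1, rfl⟩
      · exact h.adj i a b h1 h2
      · omega
    · rcases key _ _ h1 with ⟨l1, h1⟩ | ⟨l1, rfl⟩
      · obtain rfl : i = p.length := by omega
        rw [hlast a h1]
        exact ha
      · omega
  · intro a b h1 h2
    rcases key _ _ h2 with ⟨l2, h2⟩ | ⟨l2, rfl⟩
    · rcases key _ _ h1 with ⟨l1, h1⟩ | ⟨l1, rfl⟩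
      · exact h.zero a b h1 h2
      · omega
    · rcases key _ _ h1 with ⟨l1, h1⟩ | ⟨l1, rfl⟩
      · have hp : p.length = 0 := by omega
        have : p = [] := List.length_eq_zero_iff.1 hp
        rw [hlast a (by rw [hp]; exact h1)]
        exact h0 this
      · omega
  · intro i a b c h1 h2 h3
    rcases key _ _ h1 with ⟨l1, h1b⟩ | ⟨l1, rfl⟩
    · rcases key _ _ h2 with ⟨l2, h2b⟩ | ⟨l2, rfl⟩
      · rcases key _ _ h3 with ⟨l3, h3b⟩ | ⟨l3, rfl⟩
        · exact h.col i a b c h1b h2b h3b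
        · have hp : p.length = i + 1 := by omega
          have hb : b = v := hlast b (by rw [hp]; exact h2b)
          subst hb
          rcases List.eq_nil_or_concat p with rfl | ⟨q, a', rfl⟩
          · simp at hp
          · have hq : q.length = i := by simpa using hp
            have : a = a' := by
              subst hq
              simpa using h1b.symm
            subst this
            exact hc q a (by simp)
      · rcases key _ _ h3 with ⟨l3, h3⟩ | ⟨l3, rfl⟩ <;> omega
    · rcases key _ _ h2 with ⟨l2, h2⟩ | ⟨l2, rfl⟩ <;> omega

theorem OPath.openIdx {V : Type*} {E : V → V → Prop} {Z : Set V} {y : V}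
    (hasym : ∀ a b, E a b → ¬ E b a) {q : List V} {d : Bool}
    (h : OPath E Z y q d) :
    OpenIdx E Z q.reverse ∧ LastDir E q d ∧ q.getLast? = some y := by
  induction h with
  | nil =>
    refine ⟨⟨by simp, ?_, ?_, ?_⟩, rfl, rfl⟩
    · intro i a b h1 h2; simp at h2
    · intro a b h1 h2; simp at h2
    · intro i a b c h1 h2; simp at h2
  | @fwd d v w l hp hv he hn ih =>
    obtain ⟨h1, h2, h3⟩ := ih
    refine ⟨?_, by simpa [LastDir] using he, by simpa using h3⟩
    rw [List.reverse_cons, List.reverse_cons]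
    rw [List.reverse_cons] at h1
    refine h1.snoc (by simpa [and_comm] using hn) (Or.inl he) (fun _ => hv) ?_
    intro q a hq
    exact ⟨fun h => absurd h.2 (hasym _ _ he), fun _ => hv⟩
  | @bwdT v w l hp hv he hn ih =>
    obtain ⟨h1, h2, h3⟩ := ih
    refine ⟨?_, by simpa [LastDir] using he, by simpa using h3⟩
    rw [List.reverse_cons, List.reverse_cons]
    rw [List.reverse_cons] at h1
    refine h1.snoc (by simpa [and_comm] using hn) (Or.inr he) (fun _ => hv) ?_
    intro q a hq
    have hl : l = a :: q.reverse := by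
      have := congrArg List.reverse hq
      simpa using this
    subst hl
    simp [LastDir] at h2
    exact ⟨fun h => absurd h.1 (hasym _ _ h2), fun _ => hv⟩
  | @bwdH v w l hp hv he hn ih =>
    obtain ⟨h1, h2, h3⟩ := ih
    refine ⟨?_, by simpa [LastDir] using he, by simpa using h3⟩
    rw [List.reverse_cons, List.reverse_cons]
    rw [List.reverse_cons] at h1
    refine h1.snoc (by simpa [and_comm] using hn) (Or.inr he) ?_ ?_
    · intro hl
      simp at hl
      subst hl
      simp [LastDir] at h2
    intro q a hq
    have hl : l = a :: q.reverse := by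
      have := congrArg List.reverse hq
      simpa using this
    subst hl
    simp [LastDir] at h2
    exact ⟨fun _ => hv, fun h => absurd ⟨h2, he⟩ h⟩

theorem DAG.irr {V : Type*} (G : DAG V) (v : V) : ¬ G.edge v v :=
  fun h => G.acyclic v (.single h)

theorem DAG.asym {V : Type*} (G : DAG V) (a b : V) (h : G.edge a b) : ¬ G.edge b a :=
  fun h' => G.acyclic a (.tail (.single h) h')

theorem BReach.exists_path {V : Type*} (G : DAG V) {Z : Set V} {y v : V} {d : Bool}
    (h : BReach G.edge Z y d v) (hvy : v ≠ y) (hv : v ∉ Z) :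
    ∃ p, PathBetween G.edge p y v ∧ ¬ Blocked G.edge Z p := by
  obtain ⟨l, d', hp, -, -⟩ := h.toOPath G.irr
  obtain ⟨h1, h2, h3⟩ := hp.openIdx G.asym
  have hlen : 2 ≤ (v :: l).reverse.length := by
    cases l with
    | nil => simp at h3; exact absurd h3 hvy
    | cons a l => simp
  refine ⟨(v :: l).reverse, ⟨⟨hlen, h1.nodup, ?_⟩, ?_, ?_⟩, ?_⟩
  · intro i hi
    exact h1.adj i _ _ (List.getElem?_eq_getElem (by omega)) (List.getElem?_eq_getElem (by omega))
  · rw [List.head?_reverse]; exact h3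
  · simp
  · generalize hP : (v :: l).reverse = P at *
    have hPl : P[P.length - 1]? = some v := by
      rw [← List.getLast?_eq_getElem?, ← hP]; simp
    rintro (⟨i, hi, hc, hz⟩ | ⟨i, hi, hc, hz, hw⟩)
    · rw [isColliderAt_iff] at hc
      rcases Nat.eq_zero_or_pos i with rfl | hpos
      · exact h1.zero _ _ (List.getElem?_eq_getElem hi) (List.getElem?_eq_getElem (by omega)) hz
      · obtain ⟨j, rfl⟩ : ∃ j, i = j + 1 := ⟨i - 1, by omega⟩
        by_cases hl : j + 2 < P.length
        · refine (h1.col j _ _ _ (List.getElem?_eq_getElem (by omega))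
            (List.getElem?_eq_getElem hi) (List.getElem?_eq_getElem hl)).2 ?_ hz
          intro hcc
          exact hc ⟨j, _, _, _, rfl, List.getElem?_eq_getElem (by omega),
            List.getElem?_eq_getElem hi, List.getElem?_eq_getElem hl, hcc⟩
        · have : P.length - 1 = j + 1 := by omega
          rw [this, List.getElem?_eq_getElem hi] at hPl
          have := Option.some.inj hPl
          simp only [List.get_eq_getElem] at hz
          rw [this] at hz
          exact hv hz
    · rw [isColliderAt_iff] at hc
      obtain ⟨j, a, b, c, rfl, ha, hb, hcc, e⟩ := hc
      obtain ⟨z, hz', hbz⟩ := (h1.col j a b c ha hb hcc).1 e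
      have hb' : P[j+1] = b := by
        rw [List.getElem?_eq_getElem hi] at hb; exact Option.some.inj hb
      simp only [List.get_eq_getElem, hb'] at hz hw
      rcases Relation.reflTransGen_iff_eq_or_transGen.1 hbz with rfl | h
      · exact hz hz'
      · exact hw z h hz'

theorem BReach.of_path {V : Type*} (G : DAG V) {Z : Set V} {y v : V}
    {p : List V} (hp : PathBetween G.edge p y v) (hb : ¬ Blocked G.edge Z p) :
    ∃ d, BReach G.edge Z y d v := by
  obtain ⟨⟨hlen, hnd, hadj⟩, hh, hl⟩ := hp
  have hb1 : ∀ i (h : i < p.length), ¬ IsColliderAt G.edge p i → p[i] ∉ Z := by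
    intro i h hc hz
    exact hb (Or.inl ⟨i, h, hc, hz⟩)
  have hb2 : ∀ i (h : i < p.length), IsColliderAt G.edge p i → AncOf G.edge Z p[i] := by
    intro i h hc
    by_contra hcon
    refine hb (Or.inr ⟨i, h, hc, fun hz => hcon ⟨_, hz, .refl⟩, fun w hw hz => hcon ⟨w, hz, ?_⟩⟩)
    exact hw.to_reflTransGen
  have hy : p[0] = y := by
    rw [List.head?_eq_getElem?, List.getElem?_eq_getElem (by omega)] at hh
    exact Option.some.inj hh
  have main : ∀ k (h : k + 1 < p.length), (G.edge p[k] p[k+1] ∧ BReach G.edge Z y true p[k+1]) ∨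
      (G.edge p[k+1] p[k] ∧ BReach G.edge Z y false p[k+1]) := by
    intro k
    induction k with
    | zero =>
      intro h
      have h0 : p[0] ∉ Z := hb1 0 (by omega) (by rintro ⟨h, -⟩; omega)
      have hs : BReach G.edge Z y false p[0] := by rw [hy]; exact .start
      rcases hadj 0 h with e | e
      · exact Or.inl ⟨e, hs.fwd h0 e⟩
      · exact Or.inr ⟨e, hs.bwdT h0 e⟩
    | succ k ih =>
      intro h
      have e := hadj (k+1) h
      simp only [List.get_eq_getElem] at e
      rcases ih (by omega) with ⟨e1, r⟩ | ⟨e1, r⟩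
      · rcases e with e | e
        · refine Or.inl ⟨e, r.fwd (hb1 _ _ ?_) e⟩
          rintro ⟨_, _, _, e'⟩
          exact G.asym _ _ e e'
        · refine Or.inr ⟨e, r.bwdAn (hb2 _ _ ?_) e⟩
          exact ⟨by omega, h, e1, e⟩
      · have hn : p[k+1] ∉ Z := by
          apply hb1
          rintro ⟨_, _, e', _⟩
          exact G.asym _ _ e1 e'
        rcases e with e | e
        · exact Or.inl ⟨e, r.fwd hn e⟩
        · exact Or.inr ⟨e, r.bwdT hn e⟩
  have hv : p[p.length - 2 + 1] = v := by
    rw [List.getLast?_eq_getElem?, List.getElem?_eq_getElem (by omega)] at hl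
    have h2 := Option.some.inj hl
    have : p.length - 2 + 1 = p.length - 1 := by omega
    simp only [this, h2]
  rcases main (p.length - 2) (by omega) with ⟨_, r⟩ | ⟨_, r⟩
  · rw [hv] at r; exact ⟨_, r⟩
  · rw [hv] at r; exact ⟨_, r⟩

@[simp] theorem some_mem_XSet {ι : Type*} (S : Finset ι) (i : ι) : some i ∈ XSet S ↔ i ∈ S := by
  simp [XSet]

@[simp] theorem none_mem_XSet {ι : Type*} (S : Finset ι) : (none : Option ι) ∉ XSet S := by
  simp [XSet]

theorem dsep_iff {ι : Type*} (G : DAG (Option ι)) (W C : Finset ι) (hd : ∀ i ∈ W, i ∉ C) :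
    DSep G.edge {none} (XSet W) (XSet C) ↔
      ∀ i ∈ W, ∀ d, ¬ BReach G.edge (XSet C) none d (some i) := by
  constructor
  · intro h i hi d hr
    obtain ⟨p, hp, hb⟩ := hr.exists_path G (by simp) (by simpa using hd i hi)
    exact hb (h p none (some i) hp rfl (by simpa using hi))
  · rintro h p u v hp rfl ⟨i, hi, rfl⟩
    by_contra hb
    obtain ⟨d, hr⟩ := BReach.of_path G hp hb
    exact h i hi d hr

theorem simG_iff {ι : Type*} [DecidableEq ι] (G : DAG (Option ι)) (S T : Finset ι) :
    SimG G S T ↔ ∃ C : Finset ι, C ⊆ S ∧ C ⊆ T ∧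
      ∀ i, (i ∈ S ∨ i ∈ T) → i ∉ C → ∀ d, ¬ BReach G.edge (XSet C) none d (some i) := by
  unfold SimG
  refine exists_congr fun C => ?_
  rw [dsep_iff _ _ _ (by intro i hi; exact (Finset.mem_sdiff.1 hi).2), Finset.subset_inter_iff,
    and_assoc]
  refine and_congr_right fun _ => and_congr_right fun _ => ?_
  simp only [Finset.mem_sdiff, Finset.mem_union, and_imp]

open Classical in
/-- The Markov boundary of `S`. -/
noncomputable def mbd {ι : Type*} [DecidableEq ι] (G : DAG (Option ι)) (S : Finset ι) : Finset ι :=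
  S.filter fun i => ∃ d, BReach G.edge (XSet (S.erase i)) none d (some i)

theorem mem_mbd {ι : Type*} [DecidableEq ι] (G : DAG (Option ι)) (S : Finset ι) (i : ι) :
    i ∈ mbd G S ↔ i ∈ S ∧ ∃ d, BReach G.edge (XSet (S.erase i)) none d (some i) := by
  classical
  unfold mbd
  simp only [Finset.mem_filter]

theorem mbd_sub {ι : Type*} [DecidableEq ι] (G : DAG (Option ι)) (S T C : Finset ι)
    (hS : C ⊆ S) (hT : C ⊆ T)
    (hC : ∀ i, (i ∈ S ∨ i ∈ T) → i ∉ C → ∀ d, ¬ BReach G.edge (XSet C) none d (some i)) :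
    mbd G S ⊆ mbd G T := by
  intro i hi
  rw [mem_mbd] at hi ⊢
  obtain ⟨hiS, d, hr⟩ := hi
  -- a vertex reachable given `C` behaves the same for all conditioning sets
  have hmem : ∀ d v, BReach G.edge (XSet C) none d v → v ≠ some i →
      (v ∈ XSet (S.erase i) ↔ v ∈ XSet C) ∧ (v ∈ XSet (T.erase i) ↔ v ∈ XSet C) := by
    intro d v hv hne
    cases v with
    | none => simp
    | some j =>
      have hj : j ≠ i := fun h => hne (by rw [h])
      simp only [some_mem_XSet, Finset.mem_erase, ne_eq, hj, not_false_eq_true, true_and]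
      have := fun h1 h2 => hC j h1 h2 d hv
      have h1 := @hS j
      have h2 := @hT j
      tauto
  by_cases hiC : i ∈ C
  · refine ⟨hT hiC, ?_⟩
    have main : ∀ d v, BReach G.edge (XSet (S.erase i)) none d v →
        (∃ d, BReach G.edge (XSet (T.erase i)) none d (some i)) ∨
        (BReach G.edge (XSet C) none d v ∧ BReach G.edge (XSet (T.erase i)) none d v) := by
      intro d v h
      induction h with
      | start => exact Or.inr ⟨.start, .start⟩
      | @fwd d v w hr hv he ih =>
        rcases ih with ih | ⟨h1, h2⟩
        · exact Or.inl ih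
        by_cases hvi : v = some i
        · subst hvi; exact Or.inl ⟨_, h2⟩
        · obtain ⟨g1, g2⟩ := hmem _ _ h1 hvi
          rw [g1] at hv
          exact Or.inr ⟨h1.fwd hv he, h2.fwd (by rwa [g2]) he⟩
      | @bwdT v w hr hv he ih =>
        rcases ih with ih | ⟨h1, h2⟩
        · exact Or.inl ih
        by_cases hvi : v = some i
        · subst hvi; exact Or.inl ⟨_, h2⟩
        · obtain ⟨g1, g2⟩ := hmem _ _ h1 hvi
          rw [g1] at hv
          exact Or.inr ⟨h1.bwdT hv he, h2.bwdT (by rwa [g2]) he⟩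
      | @bwdH v w hr hv he ih =>
        rcases ih with ih | ⟨h1, h2⟩
        · exact Or.inl ih
        by_cases hvi : v = some i
        · subst hvi; exact Or.inl ⟨_, h2⟩
        · obtain ⟨g1, g2⟩ := hmem _ _ h1 hvi
          rw [g1] at hv
          exact Or.inr ⟨h1.bwdH hv he, h2.bwdH (by rwa [g2]) he⟩
    rcases main d _ hr with h | h
    · exact h
    · exact ⟨_, h.2⟩
  · exfalso
    have hne : ∀ d v, BReach G.edge (XSet C) none d v → v ≠ some i := by
      rintro d v h rfl
      exact hC i (Or.inl hiS) hiC d h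
    have main : ∀ d v, BReach G.edge (XSet (S.erase i)) none d v →
        BReach G.edge (XSet C) none d v := by
      intro d v h
      induction h with
      | start => exact .start
      | fwd hr hv he ih => exact ih.fwd (by rwa [(hmem _ _ ih (hne _ _ ih)).1] at hv) he
      | bwdT hr hv he ih => exact ih.bwdT (by rwa [(hmem _ _ ih (hne _ _ ih)).1] at hv) he
      | bwdH hr hv he ih => exact ih.bwdH (by rwa [(hmem _ _ ih (hne _ _ ih)).1] at hv) he
    exact hne _ _ (main d _ hr) rfl

theorem mbd_eq {ι : Type*} [DecidableEq ι] (G : DAG (Option ι)) (S T : Finset ι)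
    (h : SimG G S T) : mbd G S = mbd G T := by
  obtain ⟨C, h1, h2, h3⟩ := (simG_iff G S T).1 h
  exact (mbd_sub G S T C h1 h2 h3).antisymm
    (mbd_sub G T S C h2 h1 (fun i hi => h3 i hi.symm))

theorem mbd_eq_of_quot {ι : Type*} [DecidableEq ι] (G : DAG (Option ι)) (S T : Finset ι)
    (h : Quot.mk (SimG G) S = Quot.mk (SimG G) T) : mbd G S = mbd G T :=
  congrArg (Quot.lift (mbd G) (fun a b hab => mbd_eq G a b hab)) h

/-- Every class has a representative that is its own Markov boundary. -/
theorem exists_min_rep {ι : Type*} [DecidableEq ι] (G : DAG (Option ι)) (q : Quot (SimG G)) :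
    ∃ T, Quot.mk (SimG G) T = q ∧ ∀ i ∈ T, ∃ d, BReach G.edge (XSet (T.erase i)) none d (some i) := by
  classical
  have hex : ∃ n, ∃ T : Finset ι, Quot.mk (SimG G) T = q ∧ T.card = n := by
    obtain ⟨T, hT⟩ := Quot.exists_rep q
    exact ⟨_, T, hT, rfl⟩
  obtain ⟨T, hT, hc⟩ := Nat.find_spec hex
  refine ⟨T, hT, fun i hi => ?_⟩
  by_contra hcon
  push Not at hcon
  have hsim : SimG G T (T.erase i) := by
    rw [simG_iff]
    refine ⟨T.erase i, Finset.erase_subset _ _, subset_rfl, ?_⟩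
    intro j hj hj' d
    have : j = i := by
      by_contra hne
      simp [hne] at hj hj'
      exact hj' hj
    subst this
    exact hcon d
  have h1 : Quot.mk (SimG G) (T.erase i) = q := by rw [← hT]; exact (Quot.sound hsim).symm
  have h2 := Nat.find_min' hex ⟨_, h1, rfl⟩
  have h3 := Finset.card_erase_lt_of_mem hi
  omega

/-- The first visit of `x`. -/
theorem BReach.first {V : Type*} {E : V → V → Prop} {Z : Set V} {y : V} (x : V)
    {d : Bool} {v : V} (h : BReach E Z y d v) :
    (∃ d', BReach E Z y d' x ∧ BReach E (insert x Z) y d' x) ∨ BReach E (insert x Z) y d v := by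
  induction h with
  | start => exact Or.inr .start
  | @fwd d v w hr hv he ih =>
    rcases ih with ih | ih
    · exact Or.inl ih
    by_cases hx : v = x
    · subst hx; exact Or.inl ⟨_, hr, ih⟩
    · exact Or.inr (ih.fwd (by simp [hx, hv]) he)
  | @bwdT v w hr hv he ih =>
    rcases ih with ih | ih
    · exact Or.inl ih
    by_cases hx : v = x
    · subst hx; exact Or.inl ⟨_, hr, ih⟩
    · exact Or.inr (ih.bwdT (by simp [hx, hv]) he)
  | @bwdH v w hr hv he ih =>
    rcases ih with ih | ih
    · exact Or.inl ih
    by_cases hx : v = x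
    · subst hx; exact Or.inl ⟨_, hr, ih⟩
    · exact Or.inr (ih.bwdH (by simp [hv]) he)

/-- Reachability in exactly `n+1` skeleton steps inside `X0`. -/
def LevN {ι : Type*} (G : DAG (Option ι)) (X0 : Finset ι) : ℕ → ι → Prop
  | 0, i => i ∈ X0 ∧ SkelAdj G none (some i)
  | n + 1, j => j ∈ X0 ∧ ∃ i, LevN G X0 n i ∧ SkelAdj G (some i) (some j)

theorem LevN.mem {ι : Type*} {G : DAG (Option ι)} {X0 : Finset ι} {n : ℕ} {i : ι}
    (h : LevN G X0 n i) : i ∈ X0 := by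
  cases n with
  | zero => exact h.1
  | succ n => exact h.1

/-- The family of `|X0|` extra classes. -/
theorem extra_classes {ι : Type*} [DecidableEq ι] (G : DAG (Option ι)) (X0 : Finset ι)
    (hconn : ∀ a ∈ X0, ∀ b ∈ X0,
      Relation.ReflTransGen
        (fun u v : ι => u ∈ X0 ∧ v ∈ X0 ∧ SkelAdj G (some u) (some v)) a b)
    (hadj : ∃ i ∈ X0, SkelAdj G none (some i)) :
    ∃ (r : ι → ℕ) (A : ι → Finset ι), ∀ x ∈ X0, A x ⊆ X0 ∧ (∀ a ∈ A x, r a < r x) ∧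
      ∃ d, BReach G.edge (XSet (A x)) none d (some x) := by
  classical
  have hlev : ∀ x ∈ X0, ∃ n, LevN G X0 n x := by
    obtain ⟨i, hi, hi'⟩ := hadj
    intro x hx
    have h := hconn i hi x hx
    induction h with
    | refl => exact ⟨0, hi, hi'⟩
    | @tail b c _ hbc ih =>
      obtain ⟨n, hn⟩ := ih hbc.1
      exact ⟨n + 1, hbc.2.1, b, hn, hbc.2.2⟩
  set r : ι → ℕ := fun x => sInf {n | LevN G X0 n x} with hr
  have key : ∀ n, ∀ x ∈ X0, r x = n → ∃ A : Finset ι, A ⊆ X0 ∧ (∀ a ∈ A, r a < r x) ∧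
      ∃ d, BReach G.edge (XSet A) none d (some x) := by
    intro n
    induction n using Nat.strong_induction_on with
    | _ n IH =>
    intro x hx hrx
    have hmem : LevN G X0 (r x) x := Nat.sInf_mem (s := {n | LevN G X0 n x}) (hlev x hx)
    cases n with
    | zero =>
      rw [hrx] at hmem
      refine ⟨∅, by simp, by simp, ?_⟩
      rcases hmem.2 with e | e
      · exact ⟨_, BReach.start.fwd (by simp) e⟩
      · exact ⟨_, BReach.start.bwdT (by simp) e⟩
    | succ n =>
      rw [hrx] at hmem
      obtain ⟨i, hi, hix⟩ := hmem.2
      have hri : r i ≤ n := Nat.sInf_le (s := {n | LevN G X0 n i}) hi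
      obtain ⟨A, hA, hAr, d, hd⟩ := IH (r i) (by omega) i hi.mem rfl
      have hiA : i ∉ A := fun h => lt_irrefl _ (hAr i h)
      have hiZ : some i ∉ XSet A := by simpa using hiA
      have hAr' : ∀ a ∈ A, r a < r x := fun a ha => by have := hAr a ha; omega
      rcases hix with e | e
      · exact ⟨A, hA, hAr', _, hd.fwd hiZ e⟩
      · have : ∃ d', BReach G.edge (XSet A) none d' (some i) ∧
            BReach G.edge (insert (some i) (XSet A)) none d' (some i) := by
          rcases hd.first (some i) with h | h
          · exact h
          · exact ⟨d, hd, h⟩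
        obtain ⟨d', h1, h2⟩ := this
        cases d' with
        | false => exact ⟨A, hA, hAr', _, h1.bwdT hiZ e⟩
        | true =>
          have hins : insert (some i) (XSet A) = XSet (insert i A) := by
            ext v
            cases v <;> simp
          rw [hins] at h2
          refine ⟨insert i A, ?_, ?_, _, h2.bwdH (by simp) e⟩
          · exact Finset.insert_subset hi.mem hA
          · intro a ha
            rcases Finset.mem_insert.1 ha with rfl | ha
            · omega
            · exact hAr' a ha
  have key' : ∀ x, ∃ A : Finset ι, x ∈ X0 → A ⊆ X0 ∧ (∀ a ∈ A, r a < r x) ∧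
      ∃ d, BReach G.edge (XSet A) none d (some x) := by
    intro x
    by_cases hx : x ∈ X0
    · obtain ⟨A, h⟩ := key _ x hx rfl
      exact ⟨A, fun _ => h⟩
    · exact ⟨∅, fun h => absurd h hx⟩
  choose A hA using key'
  exact ⟨r, A, hA⟩

/-- Walks in `G` restrict to walks in the contraction. -/
theorem contract_reach {ι : Type*} [DecidableEq ι] (G : DAG (Option ι)) (X0 A : Finset ι)
    (hA : A ⊆ X0) (T : Finset {i : ι // i ∉ X0}) (d : Bool) (v : Option ι)
    (h : BReach G.edge (XSet (A ∪ T.map (Function.Embedding.subtype _))) none d v) :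
    ∀ (i : ι) (hi : i ∉ X0), v = some i →
      BReach (contractEdgeSet G.edge X0) (XSet T) none d (some ⟨i, hi⟩) := by
  have hmem : ∀ i (hi : i ∉ X0), some i ∈ XSet (A ∪ T.map (Function.Embedding.subtype _)) ↔
      some ⟨i, hi⟩ ∈ XSet T := by
    intro i hi
    have : i ∉ A := fun h => hi (hA h)
    simp [this, hi]
  induction h with
  | start => intro i hi h; simp at h
  | @fwd d v w hr hv he ih =>
    rintro i hi rfl
    cases v with
    | none => exact BReach.start.fwd (by simp) (Or.inl he)
    | some j =>
      by_cases hj : j ∈ X0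
      · exact BReach.start.fwd (by simp) (Or.inr ⟨j, hj, he⟩)
      · exact (ih j hj rfl).fwd (by rwa [← hmem]) he
  | @bwdT v w hr hv he ih =>
    rintro i hi rfl
    cases v with
    | none => exact BReach.start.bwdT (by simp) (Or.inl he)
    | some j =>
      by_cases hj : j ∈ X0
      · exact BReach.start.bwdT (by simp) (Or.inr ⟨j, hj, he⟩)
      · exact (ih j hj rfl).bwdT (by rwa [← hmem]) he
  | @bwdH v w hr hv he ih =>
    rintro i hi rfl
    cases v with
    | none => simp at hv
    | some j =>
      by_cases hj : j ∈ X0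
      · exact BReach.start.bwdT (by simp) (Or.inr ⟨j, hj, he⟩)
      · exact (ih j hj rfl).bwdH (by rwa [← hmem]) he

theorem contract_sim {ι : Type*} [DecidableEq ι] (G : DAG (Option ι)) (X0 A : Finset ι)
    (hacyc : ∀ v, ¬ Relation.TransGen (contractEdgeSet G.edge X0) v v)
    (hA : A ⊆ X0) (T T' : Finset {i : ι // i ∉ X0})
    (h : SimG (⟨contractEdgeSet G.edge X0, hacyc⟩ : DAG (Option {i : ι // i ∉ X0})) T T') :
    SimG G (A ∪ T.map (Function.Embedding.subtype _))
      (A ∪ T'.map (Function.Embedding.subtype _)) := by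
  rw [simG_iff] at h ⊢
  obtain ⟨C, h1, h2, h3⟩ := h
  refine ⟨A ∪ C.map (Function.Embedding.subtype _),
    Finset.union_subset_union_right (Finset.map_subset_map.2 h1),
    Finset.union_subset_union_right (Finset.map_subset_map.2 h2), ?_⟩
  intro i hi hiC d hr
  have hi' : ∃ hi : i ∉ X0, (⟨i, hi⟩ : {i : ι // i ∉ X0}) ∈ T ∨ (⟨i, hi⟩ : {i : ι // i ∉ X0}) ∈ T' := by
    simp at hi hiC
    obtain ⟨hiA, -⟩ := hiC
    simp [hiA] at hi
    rcases hi with ⟨a, b⟩ | ⟨a, b⟩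
    · exact ⟨a, Or.inl b⟩
    · exact ⟨a, Or.inr b⟩
  obtain ⟨hiX, hiT⟩ := hi'
  refine h3 ⟨i, hiX⟩ hiT ?_ d (contract_reach G X0 A hA C d _ hr i hiX rfl)
  intro hc
  exact hiC (by simp [hiX, hc])

/-- Membership in `X0 ∪ {Y}`. -/
def InH {ι : Type*} (X0 : Finset ι) (v : Option ι) : Prop := v = none ∨ ∃ i ∈ X0, v = some i

open Classical in
/-- The sinks of `X0 ∪ {Y}` in `X0` that are not ancestors of `T`. -/
noncomputable def sinkSet {ι : Type*} (G : DAG (Option ι)) (X0 T : Finset ι) : Finset ι :=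
  X0.filter fun i => (∀ w, InH X0 w → ¬ G.edge (some i) w) ∧
    ∀ t ∈ T, ¬ Relation.TransGen G.edge (some i) (some t)

theorem mem_sinkSet {ι : Type*} (G : DAG (Option ι)) (X0 T : Finset ι) (i : ι) :
    i ∈ sinkSet G X0 T ↔ i ∈ X0 ∧ (∀ w, InH X0 w → ¬ G.edge (some i) w) ∧
    ∀ t ∈ T, ¬ Relation.TransGen G.edge (some i) (some t) := by
  classical
  unfold sinkSet
  simp only [Finset.mem_filter]

theorem sink_cases {ι : Type*} [Fintype ι] (G : DAG (Option ι)) (X0 T : Finset ι)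
    (v : Option ι) : InH X0 v → Relation.ReflTransGen G.edge v none ∨
      (∃ s ∈ sinkSet G X0 T, Relation.ReflTransGen G.edge v (some s)) ∨
      ∃ t ∈ T, Relation.TransGen G.edge v (some t) := by
  have hwf : WellFounded (fun a b : Option ι => Relation.TransGen G.edge b a) := by
    have : IsTrans (Option ι) (fun a b : Option ι => Relation.TransGen G.edge b a) :=
      ⟨fun a b c h1 h2 => h2.trans h1⟩
    have : Std.Irrefl (fun a b : Option ι => Relation.TransGen G.edge b a) :=
      ⟨fun a h => G.acyclic a h⟩
    exact Finite.wellFounded_of_trans_of_irrefl _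
  induction v using hwf.induction with
  | _ v IH =>
  rintro (rfl | ⟨i, hi, rfl⟩)
  · exact Or.inl .refl
  · by_cases hs : i ∈ sinkSet G X0 T
    · exact Or.inr (Or.inl ⟨i, hs, .refl⟩)
    · by_cases ht : ∃ t ∈ T, Relation.TransGen G.edge (some i) (some t)
      · exact Or.inr (Or.inr ht)
      · have : ∃ w, InH X0 w ∧ G.edge (some i) w := by
          by_contra hcon
          push Not at hcon ht
          exact hs ((mem_sinkSet _ _ _ _).2 ⟨hi, hcon, ht⟩)
        obtain ⟨w, hw, e⟩ := this
        rcases IH w (.single e) hw with h | ⟨s, hs, h⟩ | ⟨t, ht, h⟩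
        · exact Or.inl (.head e h)
        · exact Or.inr (Or.inl ⟨s, hs, .head e h⟩)
        · exact Or.inr (Or.inr ⟨t, ht, .head e h⟩)

theorem reach_up {V : Type*} {E : V → V → Prop} {Z : Set V} {y v : V}
    (h : Relation.ReflTransGen E v y) : ¬ AncOf E Z v → BReach E Z y false v := by
  induction h using Relation.ReflTransGen.head_induction_on with
  | refl => intro _; exact .start
  | @head a c hac hcz ih =>
    intro hn
    have hc : ¬ AncOf E Z c := fun h => hn (h.step hac)
    exact (ih hc).bwdT (fun h => hc ⟨c, h, .refl⟩) hac

theorem reach_down {V : Type*} {E : V → V → Prop} {Z : Set V} {y v t : V} {d : Bool}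
    (hr : BReach E Z y d v) (h : Relation.TransGen E v t) (hn : ¬ AncOf E Z v) :
    BReach E Z y true t := by
  induction h with
  | single h => exact hr.fwd (fun h => hn ⟨v, h, .refl⟩) h
  | @tail b c hab hbc ih =>
    exact ih.fwd (fun h => hn ⟨b, h, hab.to_reflTransGen⟩) hbc

/-- The key lifting result. -/
theorem lift_reach {ι : Type*} [DecidableEq ι] [Fintype ι]
    (G : DAG (Option ι)) (X0 : Finset ι)
    (hconn : ∀ a ∈ X0, ∀ b ∈ X0,
      Relation.ReflTransGen
        (fun u v : ι => u ∈ X0 ∧ v ∈ X0 ∧ SkelAdj G (some u) (some v)) a b)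
    (hadj : ∃ i ∈ X0, SkelAdj G none (some i))
    (T : Finset {i : ι // i ∉ X0}) (TT : Finset ι) (hTT : TT = T.map (Function.Embedding.subtype _))
    (t : {i : ι // i ∉ X0}) (ht : t ∈ T) (d : Bool)
    (h : BReach (contractEdgeSet G.edge X0) (XSet (T.erase t)) none d (some t)) :
    ∃ d, BReach G.edge (XSet ((sinkSet G X0 TT ∪ TT).erase t.1)) none d (some t.1) := by
  set A := sinkSet G X0 TT with hAdef
  set Z : Set (Option ι) := XSet ((A ∪ TT).erase t.1) with hZ
  by_contra hcon
  push Not at hcon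
  have hAX : ∀ i ∈ A, i ∈ X0 := fun i hi => ((mem_sinkSet _ _ _ _).1 hi).1
  have hTX : ∀ i, i ∈ TT ↔ ∃ hi : i ∉ X0, (⟨i, hi⟩ : {i : ι // i ∉ X0}) ∈ T := by
    intro i; rw [hTT]; simp
  have htTT : t.1 ∈ TT := (hTX _).2 ⟨t.2, ht⟩
  have hZX0 : ∀ i ∈ X0, some i ∈ Z ↔ i ∈ A := by
    intro i hi
    have h1 : i ≠ t.1 := by rintro rfl; exact t.2 hi
    have h2 : i ∉ TT := fun h => ((hTX i).1 h).1 hi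
    simp [hZ, h1, h2]
  have hZout : ∀ i (hi : i ∉ X0), some i ∈ Z ↔ some ⟨i, hi⟩ ∈ XSet (T.erase t) := by
    intro i hi
    have h1 : i ∉ A := fun h => hi (hAX i h)
    have h2 : i ∈ TT ↔ (⟨i, hi⟩ : {i : ι // i ∉ X0}) ∈ T := by rw [hTX]; simp [hi]
    have h3 : i = t.1 ↔ (⟨i, hi⟩ : {i : ι // i ∉ X0}) = t := by rw [Subtype.ext_iff]
    simp [hZ, h1, h2, h3]
  have hnoneZ : (none : Option ι) ∉ Z := by simp [hZ]
  -- vertices of `X0 ∪ {Y}` with a child in it are not in `Z`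
  have hnotZ : ∀ a b, InH X0 a → InH X0 b → G.edge a b → a ∉ Z := by
    rintro a b (rfl | ⟨i, hi, rfl⟩) hb e
    · exact hnoneZ
    · rw [hZX0 i hi, mem_sinkSet]
      exact fun h => h.2.1 b hb e
  let P : Option ι → Prop := fun a => (BReach G.edge Z none false a ∧ a ∉ Z) ∨
    (BReach G.edge Z none true a ∧ AncOf G.edge Z a)
  have hstart : P none := Or.inl ⟨.start, hnoneZ⟩
  have hhead : ∀ a, InH X0 a → BReach G.edge Z none true a → P a := by
    intro a ha hr
    by_cases hAn : AncOf G.edge Z a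
    · exact Or.inr ⟨hr, hAn⟩
    · have haZ : a ∉ Z := fun h => hAn ⟨a, h, .refl⟩
      rcases sink_cases G X0 TT a ha with h | ⟨s, hs, h⟩ | ⟨t', ht', h⟩
      · exact Or.inl ⟨reach_up h hAn, haZ⟩
      · exact absurd ⟨some s, (hZX0 s (hAX s hs)).2 hs, h⟩ hAn
      · by_cases htt : t' = t.1
        · subst htt
          exact absurd (reach_down hr h hAn) (hcon _)
        · refine absurd ⟨some t', ?_, h.to_reflTransGen⟩ hAn
          simp [hZ, htt, ht']
  have hstep : ∀ a b, InH X0 a → InH X0 b → SkelAdj G a b → P a → P b := by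
    intro a b ha hb e hP
    rcases e with e | e
    · have haZ := hnotZ a b ha hb e
      rcases hP with ⟨h1, h2⟩ | ⟨h1, h2⟩
      · exact hhead b hb (h1.fwd haZ e)
      · exact hhead b hb (h1.fwd haZ e)
    · have hbZ := hnotZ b a hb ha e
      rcases hP with ⟨h1, h2⟩ | ⟨h1, h2⟩
      · exact Or.inl ⟨h1.bwdT h2 e, hbZ⟩
      · exact Or.inl ⟨h1.bwdAn h2 e, hbZ⟩
  have hPX : ∀ i ∈ X0, P (some i) := by
    obtain ⟨i0, hi0, e0⟩ := hadj
    intro i hi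
    have h := hconn i0 hi0 i hi
    induction h with
    | refl => exact hstep none _ (Or.inl rfl) (Or.inr ⟨_, hi0, rfl⟩) e0 hstart
    | @tail b c _ hbc ih =>
      exact hstep _ _ (Or.inr ⟨_, hbc.1, rfl⟩) (Or.inr ⟨_, hbc.2.1, rfl⟩) hbc.2.2 (ih hbc.1)
  have hPH : ∀ a, InH X0 a → P a := by
    rintro a (rfl | ⟨i, hi, rfl⟩)
    · exact hstart
    · exact hPX i hi
  -- leaving `X0 ∪ {Y}`
  have hexitF : ∀ a w, InH X0 a → G.edge a w → BReach G.edge Z none true w ∨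
      ∃ s ∈ A, Relation.TransGen G.edge (some s) w := by
    intro a w ha e
    by_cases haZ : a ∈ Z
    · rcases ha with rfl | ⟨i, hi, rfl⟩
      · exact absurd haZ hnoneZ
      · exact Or.inr ⟨i, (hZX0 i hi).1 haZ, .single e⟩
    · left
      rcases hPH a ha with ⟨h1, _⟩ | ⟨h1, _⟩
      · exact h1.fwd haZ e
      · exact h1.fwd haZ e
  have hexitB : ∀ a w, InH X0 a → G.edge w a → BReach G.edge Z none false w := by
    intro a w ha e
    rcases hPH a ha with ⟨h1, h2⟩ | ⟨h1, h2⟩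
    · exact h1.bwdT h2 e
    · exact h1.bwdAn h2 e
  have main : ∀ d v, BReach (contractEdgeSet G.edge X0) (XSet (T.erase t)) none d v →
      ∀ i (hi : i ∉ X0), v = some ⟨i, hi⟩ → BReach G.edge Z none d (some i) ∨
        (d = true ∧ ∃ s ∈ A, Relation.TransGen G.edge (some s) (some i)) := by
    intro d v h
    induction h with
    | start => intro i hi h; simp at h
    | @fwd d v w hr hv he ih =>
      rintro i hi rfl
      cases v with
      | none =>
        rcases he with he | ⟨j, hj, he⟩
        · exact (hexitF _ _ (Or.inl rfl) he).imp_right fun h => ⟨rfl, h⟩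
        · exact (hexitF _ _ (Or.inr ⟨j, hj, rfl⟩) he).imp_right fun h => ⟨rfl, h⟩
      | some j =>
        obtain ⟨j, hj⟩ := j
        rcases ih j hj rfl with h | ⟨_, s, hs, h⟩
        · exact Or.inl (h.fwd (by rwa [hZout j hj]) he)
        · exact Or.inr ⟨rfl, s, hs, h.tail he⟩
    | @bwdT v w hr hv he ih =>
      rintro i hi rfl
      left
      cases v with
      | none =>
        rcases he with he | ⟨j, hj, he⟩
        · exact hexitB _ _ (Or.inl rfl) he
        · exact hexitB _ _ (Or.inr ⟨j, hj, rfl⟩) he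
      | some j =>
        obtain ⟨j, hj⟩ := j
        rcases ih j hj rfl with h | ⟨hf, _⟩
        · exact h.bwdT (by rwa [hZout j hj]) he
        · simp at hf
    | @bwdH v w hr hv he ih =>
      rintro i hi rfl
      left
      cases v with
      | none => simp at hv
      | some j =>
        obtain ⟨j, hj⟩ := j
        rcases ih j hj rfl with h | ⟨_, s, hs, h⟩
        · exact h.bwdH (by rwa [hZout j hj]) he
        · exfalso
          have hjT : j ∈ TT := (hTX j).2 ⟨hj, by simp at hv; exact hv.2⟩
          exact ((mem_sinkSet _ _ _ _).1 hs).2.2 j hjT h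
  rcases main d _ h t.1 t.2 rfl with h | ⟨_, s, hs, h⟩
  · exact hcon _ h
  · exact ((mem_sinkSet _ _ _ _).1 hs).2.2 t.1 htTT h

/-- Let `G` be a DAG over a target `Y` and covariates, `X₀` a nonempty
set of covariates that induces a connected subgraph of the skeleton, with `Y` adjacent
to some vertex of `X₀`, and every covariate outside `X₀` adjacent to at most one vertex
of `X₀ ∪ {Y}`. Let `G̃` be obtained by contracting `X₀ ∪ {Y}` into a new target `Ỹ`
(assumed acyclic). Then `N_{G̃} + |X₀| ≤ N_G ≤ 2^{|X₀|}·N_{G̃}`. -/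
theorem NG_merge_set {ι : Type*} [DecidableEq ι] [Fintype ι]
    (G : DAG (Option ι)) (X0 : Finset ι) (hne : X0.Nonempty)
    (hconn : ∀ a ∈ X0, ∀ b ∈ X0,
      Relation.ReflTransGen
        (fun u v : ι => u ∈ X0 ∧ v ∈ X0 ∧ SkelAdj G (some u) (some v)) a b)
    (hadj : ∃ i ∈ X0, SkelAdj G none (some i))
    (hone : ∀ v : ι, v ∉ X0 → ∀ a b : Option ι,
      (a = none ∨ ∃ i ∈ X0, a = some i) → (b = none ∨ ∃ i ∈ X0, b = some i) →
      SkelAdj G (some v) a → SkelAdj G (some v) b → a = b)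
    (hacyc : ∀ v, ¬ Relation.TransGen (contractEdgeSet G.edge X0) v v) :
    NG (⟨contractEdgeSet G.edge X0, hacyc⟩ : DAG (Option {i : ι // i ∉ X0})) + X0.card
        ≤ NG G ∧
    NG G ≤ 2 ^ X0.card *
        NG (⟨contractEdgeSet G.edge X0, hacyc⟩ : DAG (Option {i : ι // i ∉ X0})) := by
  classical
  set G' : DAG (Option {i : ι // i ∉ X0}) := ⟨contractEdgeSet G.edge X0, hacyc⟩ with hG'
  have : Finite (Quot (SimG G)) := Quot.finite _
  have : Finite (Quot (SimG G')) := Quot.finite _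
  constructor
  · obtain ⟨r, A, hA⟩ := extra_classes G X0 hconn hadj
    have hrep : ∀ q : Quot (SimG G'), ∃ (T : Finset {i : ι // i ∉ X0}) (S : Finset ι),
        Quot.mk (SimG G') T = q ∧ (∀ i (hi : i ∉ X0), i ∈ mbd G S ↔ ⟨i, hi⟩ ∈ T) ∧
        (T = ∅ → mbd G S = ∅) := by
      intro q
      obtain ⟨T, hT, hmin⟩ := exists_min_rep G' q
      by_cases hT0 : T = ∅
      · refine ⟨T, ∅, hT, ?_, ?_⟩
        · intro i hi; rw [mem_mbd]; simp [hT0]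
        · intro _; ext i; rw [mem_mbd]; simp
      · refine ⟨T, sinkSet G X0 (T.map (Function.Embedding.subtype _)) ∪
          T.map (Function.Embedding.subtype _), hT, ?_, fun h => absurd h hT0⟩
        intro i hi
        rw [mem_mbd]
        constructor
        · rintro ⟨h, -⟩
          rcases Finset.mem_union.1 h with h | h
          · exact absurd ((mem_sinkSet _ _ _ _).1 h).1 hi
          · simp [hi] at h; exact h
        · intro h
          refine ⟨Finset.mem_union_right _ (by simp [hi, h]), ?_⟩
          obtain ⟨d, hd⟩ := hmin _ h
          exact lift_reach G X0 hconn hadj T _ rfl ⟨i, hi⟩ h d hd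
    choose T S hTq hmb h0 using hrep
    have hSx : ∀ x ∈ X0, x ∈ mbd G (insert x (A x)) ∧ mbd G (insert x (A x)) ⊆ insert x (A x) := by
      intro x hx
      obtain ⟨h1, h2, d, h3⟩ := hA x hx
      have hxA : x ∉ A x := fun h => lt_irrefl _ (h2 x h)
      refine ⟨?_, fun i hi => ((mem_mbd _ _ _).1 hi).1⟩
      rw [mem_mbd, Finset.erase_insert hxA]
      exact ⟨by simp, d, h3⟩
    have hne' : ∀ q, ∀ x ∈ X0, mbd G (S q) ≠ mbd G (insert x (A x)) := by
      intro q x hx heq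
      obtain ⟨g1, g2⟩ := hSx x hx
      have : T q = ∅ := by
        rw [Finset.eq_empty_iff_forall_notMem]
        rintro ⟨i, hi⟩ hmem
        rw [← hmb q i hi, heq] at hmem
        rcases Finset.mem_insert.1 (g2 hmem) with rfl | h
        · exact hi hx
        · exact hi ((hA x hx).1 h)
      rw [← heq, h0 q this] at g1
      simp at g1
    let f : Quot (SimG G') ⊕ {x // x ∈ X0} → Quot (SimG G) := fun s => match s with
      | Sum.inl q => Quot.mk _ (S q)
      | Sum.inr x => Quot.mk _ (insert x.1 (A x.1))
    have hf : Function.Injective f := by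
      rintro (q | x) (q' | x') h
      · have h := mbd_eq_of_quot G _ _ h
        congr 1
        have : T q = T q' := by
          ext ⟨i, hi⟩
          rw [← hmb q i hi, ← hmb q' i hi, h]
        rw [← hTq q, ← hTq q', this]
      · exact absurd (mbd_eq_of_quot G _ _ h) (hne' q _ x'.2)
      · exact absurd (mbd_eq_of_quot G _ _ h).symm (hne' q' _ x.2)
      · have h := mbd_eq_of_quot G _ _ h
        congr 1
        by_contra hxx
        have hxx' : x.1 ≠ x'.1 := fun h => hxx (Subtype.ext h)
        obtain ⟨a1, a2⟩ := hSx _ x.2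
        obtain ⟨b1, b2⟩ := hSx _ x'.2
        have c1 : x.1 ∈ A x'.1 := by
          rw [h] at a1
          exact (Finset.mem_insert.1 (b2 a1)).resolve_left hxx'
        have c2 : x'.1 ∈ A x.1 := by
          rw [← h] at b1
          exact (Finset.mem_insert.1 (a2 b1)).resolve_left hxx'.symm
        have d1 := (hA _ x'.2).2.1 _ c1
        have d2 := (hA _ x.2).2.1 _ c2
        omega
    have := Nat.card_le_card_of_injective f hf
    rw [Nat.card_sum] at this
    simpa [NG] using this
  · let f : {A // A ∈ X0.powerset} × Quot (SimG G') → Quot (SimG G) := fun p =>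
      Quot.lift (fun T : Finset {i : ι // i ∉ X0} =>
        Quot.mk (SimG G) (p.1.1 ∪ T.map (Function.Embedding.subtype _)))
        (fun T T' h => Quot.sound
          (contract_sim G X0 p.1.1 hacyc (Finset.mem_powerset.1 p.1.2) T T' h)) p.2
    have hf : Function.Surjective f := by
      intro q
      obtain ⟨S, rfl⟩ := Quot.exists_rep q
      refine ⟨(⟨S ∩ X0, by simp⟩, Quot.mk _ (S.subtype (fun i => i ∉ X0))), ?_⟩
      change Quot.mk (SimG G) _ = Quot.mk (SimG G) S
      congr 1
      ext i
      by_cases hi : i ∈ X0 <;> simp [hi]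
    have := Nat.card_le_card_of_surjective f hf
    have hcard : Nat.card {A // A ∈ X0.powerset} = 2 ^ X0.card := by
      rw [Nat.card_eq_fintype_card, Fintype.card_coe, Finset.card_powerset]
    rw [Nat.card_prod, hcard] at this
    exact this
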